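/- Let A be a commutative unital ring, λ and u invertible in A, and n = 2l ≥ 2 even. If M_n(a_1,…,a_n) = diag(u, u^{-1}), then M_n(λa_1, λ^{-1}a_2, λa_3, …, λa_{2l−1}, λ^{-1}a_{2l}) = diag(u, u^{-1}). -/

import Mathlib

/-- `Mₙ(a₁,…,aₙ) = [[aₙ,−1],[1,0]]·[[a_{n−1},−1],[1,0]]⋯[[a₁,−1],[1,0]]`. -/
def Mn {A : Type} [CommRing A] : (n : ℕ) → (Fin n → A) → Matrix (Fin 2) (Fin 2) A
  | 0, _ => 1
  | n+1, a => !![a (Fin.last n), -1; 1, 0] * Mn n (fun i => a i.castSucc)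

/-- Scaling the entries of an even-length sequence alternately by `λ` and `λ⁻¹` conjugates
`Mₙ` by a diagonal matrix: the diagonal is unchanged, and the off-diagonal entries
are scaled by `λ⁻¹` and `λ`. -/
theorem Mn_two_mul_scaling {A : Type} [CommRing A] (lam : Aˣ) (l : ℕ) (a : Fin (2 * l) → A) :
    Mn (2 * l)
      (fun i => if (i : ℕ) % 2 = 0 then (lam : A) * a i else ((lam⁻¹ : Aˣ) : A) * a i)
      = !![Mn (2 * l) a 0 0, ((lam⁻¹ : Aˣ) : A) * Mn (2 * l) a 0 1;
          (lam : A) * Mn (2 * l) a 1 0, Mn (2 * l) a 1 1] := by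
  induction l with
  | zero => ext i j; fin_cases i <;> fin_cases j <;> simp [Mn]
  | succ l ih =>
    have ih' := ih (fun i => a i.castSucc.castSucc)
    have hlam : (lam : A) * ((lam⁻¹ : Aˣ) : A) = 1 := lam.mul_inv
    have hodd : (2 * l + 1) % 2 ≠ 0 := by omega
    have heven : 2 * l % 2 = 0 := by omega
    change Mn (2 * l + 1 + 1) _ = !![Mn (2 * l + 1 + 1) a 0 0, _ * Mn (2 * l + 1 + 1) a 0 1;
      _ * Mn (2 * l + 1 + 1) a 1 0, Mn (2 * l + 1 + 1) a 1 1]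
    simp only [Mn, Fin.val_castSucc, Fin.val_last, hodd, heven, if_true, if_false]
    rw [ih']
    generalize Mn (2 * l) (fun i => a i.castSucc.castSucc) = N
    clear ih ih' hodd heven
    ext i j
    fin_cases i <;> fin_cases j <;> simp [Matrix.mul_apply, Matrix.vecMul, dotProduct, Fin.sum_univ_two] <;> grind

/-- If `n = 2l ≥ 2` is even and `M_n(a₁,…,aₙ) = diag(u, u⁻¹)`, then
`M_n(λa₁, λ⁻¹a₂, …, λa_{2l−1}, λ⁻¹a_{2l}) = diag(u, u⁻¹)`.
(Indices are 0-based: entries in even positions are scaled by `λ`.) -/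
theorem Mn_even_scaling {A : Type} [CommRing A] (lam u : Aˣ) (l : ℕ) (hl : 1 ≤ l)
    (a : Fin (2 * l) → A)
    (h : Mn (2 * l) a = !![(u : A), 0; 0, ((u⁻¹ : Aˣ) : A)]) :
    Mn (2 * l)
      (fun i => if (i : ℕ) % 2 = 0 then (lam : A) * a i else ((lam⁻¹ : Aˣ) : A) * a i)
      = !![(u : A), 0; 0, ((u⁻¹ : Aˣ) : A)] := by
  rw [Mn_two_mul_scaling, h]
  simp
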